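/- For every ε > 0 there exists n₀ such that for all n ≥ n₀ there is a 3-uniform hypergraph G on n vertices with no 3 edges spanning at most 5 vertices and with at least (1/5 − ε)·n² edges. -/

import Mathlib

namespace Stmt9

/-- The gadget: 30 triples in `(Z/5)^3`; two coordinates agree, the third is shifted by 1 or 2. -/
def gadget : Finset (Fin 5 × Fin 5 × Fin 5) :=
  (Finset.univ : Finset (Fin 5 × Fin 3 × Fin 2)).image fun w =>
    let i := w.1
    let d : Fin 5 := if w.2.2 = 0 then i + 1 else i + 2
    if w.2.1 = 0 then (d, i, i) else if w.2.1 = 1 then (i, d, i) else (i, i, d)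

lemma gadget_card : gadget.card = 30 := by decide +kernel

/-- The edge on three labelled parts. -/
def edge {α : Type*} [DecidableEq α] (x y z : α) (t : Fin 5 × Fin 5 × Fin 5) :
    Finset (α × Fin 5) := {(x, t.1), (y, t.2.1), (z, t.2.2)}

lemma gadget_free : ∀ t₁ ∈ gadget, ∀ t₂ ∈ gadget, t₁ ≠ t₂ → ∀ t₃ ∈ gadget,
    t₁ ≠ t₃ → t₂ ≠ t₃ →
    5 < ((({t₁.1, t₂.1, t₃.1} : Finset (Fin 5)).card + ({t₁.2.1, t₂.2.1, t₃.2.1} : Finset (Fin 5)).card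
      + ({t₁.2.2, t₂.2.2, t₃.2.2} : Finset (Fin 5)).card)) := by
  decide +kernel

lemma edge_card {α : Type*} [DecidableEq α] {x y z : α} (hxy : x ≠ y) (hxz : x ≠ z) (hyz : y ≠ z)
    (t : Fin 5 × Fin 5 × Fin 5) : (edge x y z t).card = 3 := by
  unfold edge
  rw [Finset.card_eq_three]
  exact ⟨_, _, _, by simp [hxy], by simp [hxz], by simp [hyz], rfl⟩

lemma edge_inj {α : Type*} [DecidableEq α] {x y z : α} (hxy : x ≠ y) (hxz : x ≠ z) (hyz : y ≠ z)
    {t s : Fin 5 × Fin 5 × Fin 5} (h : edge x y z t = edge x y z s) : t = s := by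
  have h1 : (x, t.1) ∈ edge x y z s := by rw [← h]; simp [edge]
  have h2 : (y, t.2.1) ∈ edge x y z s := by rw [← h]; simp [edge]
  have h3 : (z, t.2.2) ∈ edge x y z s := by rw [← h]; simp [edge]
  simp [edge, hxy, hxz, hyz, hxy.symm, hxz.symm, hyz.symm] at h1 h2 h3
  exact Prod.ext h1 (Prod.ext h2 h3)

lemma same_free {α : Type*} [DecidableEq α] {x y z : α} (hxy : x ≠ y) (hxz : x ≠ z) (hyz : y ≠ z)
    {t₁ t₂ t₃ : Fin 5 × Fin 5 × Fin 5} (h₁ : t₁ ∈ gadget) (h₂ : t₂ ∈ gadget) (h₃ : t₃ ∈ gadget)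
    (h12 : t₁ ≠ t₂) (h13 : t₁ ≠ t₃) (h23 : t₂ ≠ t₃) :
    5 < (edge x y z t₁ ∪ edge x y z t₂ ∪ edge x y z t₃).card := by
  have key := gadget_free t₁ h₁ t₂ h₂ h12 t₃ h₃ h13 h23
  have e : edge x y z t₁ ∪ edge x y z t₂ ∪ edge x y z t₃ =
      (({x} : Finset α) ×ˢ ({t₁.1, t₂.1, t₃.1} : Finset (Fin 5)) ∪
       ({y} : Finset α) ×ˢ ({t₁.2.1, t₂.2.1, t₃.2.1} : Finset (Fin 5))) ∪
       ({z} : Finset α) ×ˢ ({t₁.2.2, t₂.2.2, t₃.2.2} : Finset (Fin 5)) := by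
    ext ⟨a, b⟩
    simp only [edge, Finset.mem_union, Finset.mem_insert, Finset.mem_singleton,
      Finset.mem_product, Prod.mk.injEq]
    constructor
    · rintro (((⟨rfl, rfl⟩ | ⟨rfl, rfl⟩ | ⟨rfl, rfl⟩) | (⟨rfl, rfl⟩ | ⟨rfl, rfl⟩ | ⟨rfl, rfl⟩)) |
        (⟨rfl, rfl⟩ | ⟨rfl, rfl⟩ | ⟨rfl, rfl⟩)) <;> simp
    · rintro ((⟨rfl, (rfl | rfl | rfl)⟩ | ⟨rfl, (rfl | rfl | rfl)⟩) | ⟨rfl, (rfl | rfl | rfl)⟩) <;>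
        simp
  rw [e, Finset.card_union_of_disjoint, Finset.card_union_of_disjoint]
  · simpa only [Finset.card_product, Finset.card_singleton, one_mul] using key
  · rw [Finset.disjoint_left]
    rintro ⟨a, b⟩ h h'
    simp only [Finset.mem_product, Finset.mem_singleton] at h h'
    exact hxy (h.1.symm.trans h'.1)
  · rw [Finset.disjoint_left]
    rintro ⟨a, b⟩ h h'
    simp only [Finset.mem_union, Finset.mem_product, Finset.mem_singleton] at h h'
    rcases h with h | h
    · exact hxz (h.1.symm.trans h'.1)
    · exact hyz (h.1.symm.trans h'.1)

/-- Sorted zero-sum triples. -/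
def lines (r : ℕ) [NeZero r] : Finset (Fin r × Fin r × Fin r) :=
  Finset.univ.filter fun p => p.1 < p.2.1 ∧ p.2.1 < p.2.2 ∧ p.1 + p.2.1 + p.2.2 = 0

lemma third {r : ℕ} [NeZero r] {a b c d : Fin r} (h : a + b + c = 0) (h' : a + b + d = 0) :
    c = d := add_left_cancel (h.trans h'.symm)

lemma third_elt {r : ℕ} [NeZero r] {x y z u v : Fin r} (h3 : x + y + z = 0)
    (hu : u = x ∨ u = y ∨ u = z) (hv : v = x ∨ v = y ∨ v = z) (huv : u ≠ v) :
    ∃ w, u + v + w = 0 ∧ (∀ a, (a = x ∨ a = y ∨ a = z) ↔ (a = u ∨ a = v ∨ a = w)) := by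
  rcases hu with hu | hu | hu <;> rcases hv with hv | hv | hv <;> rw [hu, hv] <;> rw [hu, hv] at huv
  · exact absurd rfl huv
  · exact ⟨z, h3, fun a => by tauto⟩
  · exact ⟨y, by rw [← h3]; abel, fun a => by tauto⟩
  · exact ⟨z, by rw [← h3]; abel, fun a => by tauto⟩
  · exact absurd rfl huv
  · exact ⟨x, by rw [← h3]; abel, fun a => by tauto⟩
  · exact ⟨y, by rw [← h3]; abel, fun a => by tauto⟩
  · exact ⟨x, by rw [← h3]; abel, fun a => by tauto⟩
  · exact absurd rfl huv

lemma lines_meet {r : ℕ} [NeZero r] {x y z x' y' z' : Fin r}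
    (h : (x, y, z) ∈ lines r) (h' : (x', y', z') ∈ lines r) (hne : (x, y, z) ≠ (x', y', z'))
    {u v : Fin r} (hu : u = x ∨ u = y ∨ u = z) (hv : v = x ∨ v = y ∨ v = z)
    (hu' : u = x' ∨ u = y' ∨ u = z') (hv' : v = x' ∨ v = y' ∨ v = z') : u = v := by
  by_contra huv
  simp only [lines, Finset.mem_filter, Finset.mem_univ, true_and] at h h'
  obtain ⟨h1, h2, h3⟩ := h
  obtain ⟨h1', h2', h3'⟩ := h'
  -- third element
  have A := third_elt h3 hu hv huv
  have B := third_elt h3' hu' hv' huv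
  obtain ⟨w, hw, hA⟩ := A
  obtain ⟨w', hw', hB⟩ := B
  obtain rfl := third hw hw'
  have C : ∀ a, (a = x ∨ a = y ∨ a = z) ↔ (a = x' ∨ a = y' ∨ a = z') := fun a =>
    (hA a).trans (hB a).symm
  have c1 := (C x).1 (by simp)
  have c2 := (C y).1 (by simp)
  have c3 := (C z).1 (by simp)
  clear hu hv hu' hv' hA hB C h3 h3' hw hw' huv
  apply hne
  simp only [Prod.mk.injEq]
  simp only [Fin.ext_iff, Fin.lt_def] at *
  omega

lemma edge_meet {r : ℕ} [NeZero r] {x y z x' y' z' : Fin r}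
    (h : (x, y, z) ∈ lines r) (h' : (x', y', z') ∈ lines r) (hne : (x, y, z) ≠ (x', y', z'))
    (s : Fin 5 × Fin 5 × Fin 5) {a b : Fin r × Fin 5}
    (ha : a ∈ edge x' y' z' s) (hb : b ∈ edge x' y' z' s)
    (ha' : a.1 = x ∨ a.1 = y ∨ a.1 = z) (hb' : b.1 = x ∨ b.1 = y ∨ b.1 = z) : a = b := by
  have hfst : ∀ c ∈ edge x' y' z' s, c.1 = x' ∨ c.1 = y' ∨ c.1 = z' := by
    intro c hc
    simp only [edge, Finset.mem_insert, Finset.mem_singleton] at hc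
    rcases hc with rfl | rfl | rfl <;> simp
  have key := lines_meet h h' hne ha' hb' (hfst a ha) (hfst b hb)
  simp only [lines, Finset.mem_filter, Finset.mem_univ, true_and] at h'
  obtain ⟨h1, h2, -⟩ := h'
  have h12 := h1.ne
  have h23 := h2.ne
  have h13 := (h1.trans h2).ne
  simp only [edge, Finset.mem_insert, Finset.mem_singleton] at ha hb
  rcases ha with rfl | rfl | rfl <;> rcases hb with rfl | rfl | rfl <;>
    first
    | rfl
    | exact absurd key h12
    | exact absurd key h13
    | exact absurd key h23
    | exact absurd key.symm h12
    | exact absurd key.symm h13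
    | exact absurd key.symm h23

lemma edge_fst {α : Type*} [DecidableEq α] {x y z : α} {s : Fin 5 × Fin 5 × Fin 5} :
    ∀ c ∈ edge x y z s, c.1 = x ∨ c.1 = y ∨ c.1 = z := by
  intro c hc
  simp only [edge, Finset.mem_insert, Finset.mem_singleton] at hc
  rcases hc with rfl | rfl | rfl <;> simp

lemma three_card {β : Type*} [DecidableEq β] {a b c : Finset β} (ha : a.card = 3)
    (hb : b.card = 3) (hc : c.card = 3) (hab : (a ∩ b).card ≤ 1) (hac : (a ∩ c).card ≤ 1)
    (hbc : (b ∩ c).card ≤ 1) : 5 < (a ∪ b ∪ c).card := by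
  have h1 := Finset.card_union_add_card_inter a b
  have h2 := Finset.card_union_add_card_inter (a ∪ b) c
  have h3 : ((a ∪ b) ∩ c).card ≤ (a ∩ c).card + (b ∩ c).card := by
    rw [Finset.union_inter_distrib_right]; exact Finset.card_union_le _ _
  omega

lemma two_one_card {β : Type*} [DecidableEq β] {a b c : Finset β} (ha : a.card = 3)
    (hb : b.card = 3) (hc : c.card = 3) (hab : a ≠ b) (h : ((a ∪ b) ∩ c).card ≤ 1) :
    5 < (a ∪ b ∪ c).card := by
  have h2 := Finset.card_union_add_card_inter (a ∪ b) c
  have h3 : 3 < (a ∪ b).card := by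
    by_contra hlt
    have e1 : a = a ∪ b := Finset.eq_of_subset_of_card_le Finset.subset_union_left (by omega)
    have e2 : b = a ∪ b := Finset.eq_of_subset_of_card_le Finset.subset_union_right (by omega)
    exact hab (e1.trans e2.symm)
  omega

/-- The hypergraph on `Fin r × Fin 5`. -/
def hyp (r : ℕ) [NeZero r] : Finset (Finset (Fin r × Fin 5)) :=
  (lines r ×ˢ gadget).image fun w => edge w.1.1 w.1.2.1 w.1.2.2 w.2

lemma lines_ne {r : ℕ} [NeZero r] {x y z : Fin r} (h : (x, y, z) ∈ lines r) :
    x ≠ y ∧ x ≠ z ∧ y ≠ z := by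
  simp only [lines, Finset.mem_filter, Finset.mem_univ, true_and] at h
  exact ⟨h.1.ne, (h.1.trans h.2.1).ne, h.2.1.ne⟩

lemma hyp_card (r : ℕ) [NeZero r] : (hyp r).card = (lines r).card * 30 := by
  rw [hyp, Finset.card_image_of_injOn, Finset.card_product, gadget_card]
  rintro ⟨⟨x, y, z⟩, t⟩ hp ⟨⟨x', y', z'⟩, s⟩ hq heq
  simp only [Finset.coe_product, Set.mem_prod, Finset.mem_coe] at hp hq heq
  obtain ⟨n1, n2, n3⟩ := lines_ne hp.1
  obtain ⟨n1', n2', n3'⟩ := lines_ne hq.1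
  by_cases hne : (x, y, z) = (x', y', z')
  · simp only [Prod.mk.injEq] at hne
    obtain ⟨rfl, rfl, rfl⟩ := hne
    rw [edge_inj n1 n2 n3 heq]
  · exfalso
    have m1 : (x', s.1) ∈ edge x' y' z' s := by simp [edge]
    have m2 : (y', s.2.1) ∈ edge x' y' z' s := by simp [edge]
    have := edge_meet hp.1 hq.1 hne s m1 m2 (edge_fst _ (heq ▸ m1)) (edge_fst _ (heq ▸ m2))
    exact n1' (Prod.ext_iff.1 this).1

lemma hyp_uniform (r : ℕ) [NeZero r] : ∀ e ∈ hyp r, e.card = 3 := by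
  intro e he
  simp only [hyp, Finset.mem_image, Finset.mem_product] at he
  obtain ⟨⟨⟨x, y, z⟩, t⟩, ⟨hp, -⟩, rfl⟩ := he
  obtain ⟨n1, n2, n3⟩ := lines_ne hp
  exact edge_card n1 n2 n3 t

lemma inter_le {r : ℕ} [NeZero r] {x y z x' y' z' : Fin r}
    (h : (x, y, z) ∈ lines r) (h' : (x', y', z') ∈ lines r) (hne : (x, y, z) ≠ (x', y', z'))
    (t t' s : Fin 5 × Fin 5 × Fin 5) :
    ((edge x y z t ∪ edge x y z t') ∩ edge x' y' z' s).card ≤ 1 := by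
  rw [Finset.card_le_one]
  intro a ha b hb
  simp only [Finset.mem_inter, Finset.mem_union] at ha hb
  exact edge_meet h h' hne s ha.2 hb.2 (ha.1.elim (edge_fst _) (edge_fst _))
    (hb.1.elim (edge_fst _) (edge_fst _))

lemma hyp_free (r : ℕ) [NeZero r] : ∀ e₁ ∈ hyp r, ∀ e₂ ∈ hyp r, ∀ e₃ ∈ hyp r,
    e₁ ≠ e₂ → e₁ ≠ e₃ → e₂ ≠ e₃ → 5 < (e₁ ∪ e₂ ∪ e₃).card := by
  intro e₁ h₁ e₂ h₂ e₃ h₃ h12 h13 h23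
  have u1 := hyp_uniform r e₁ h₁
  have u2 := hyp_uniform r e₂ h₂
  have u3 := hyp_uniform r e₃ h₃
  simp only [hyp, Finset.mem_image, Finset.mem_product] at h₁ h₂ h₃
  obtain ⟨⟨⟨x₁, y₁, z₁⟩, t₁⟩, ⟨hp₁, ht₁⟩, rfl⟩ := h₁
  obtain ⟨⟨⟨x₂, y₂, z₂⟩, t₂⟩, ⟨hp₂, ht₂⟩, rfl⟩ := h₂
  obtain ⟨⟨⟨x₃, y₃, z₃⟩, t₃⟩, ⟨hp₃, ht₃⟩, rfl⟩ := h₃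
  dsimp only at *
  by_cases c12 : (x₁, y₁, z₁) = (x₂, y₂, z₂)
  · simp only [Prod.mk.injEq] at c12
    obtain ⟨rfl, rfl, rfl⟩ := c12
    by_cases c13 : (x₁, y₁, z₁) = (x₃, y₃, z₃)
    · simp only [Prod.mk.injEq] at c13
      obtain ⟨rfl, rfl, rfl⟩ := c13
      obtain ⟨n1, n2, n3⟩ := lines_ne hp₁
      exact same_free n1 n2 n3 ht₁ ht₂ ht₃ (by rintro rfl; exact h12 rfl)
        (by rintro rfl; exact h13 rfl) (by rintro rfl; exact h23 rfl)
    · exact two_one_card u1 u2 u3 h12 (inter_le hp₁ hp₃ c13 _ _ _)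
  · by_cases c13 : (x₁, y₁, z₁) = (x₃, y₃, z₃)
    · simp only [Prod.mk.injEq] at c13
      obtain ⟨rfl, rfl, rfl⟩ := c13
      rw [Finset.union_right_comm]
      exact two_one_card u1 u3 u2 h13 (inter_le hp₁ hp₂ c12 _ _ _)
    · by_cases c23 : (x₂, y₂, z₂) = (x₃, y₃, z₃)
      · simp only [Prod.mk.injEq] at c23
        obtain ⟨rfl, rfl, rfl⟩ := c23
        rw [Finset.union_assoc, Finset.union_comm]
        exact two_one_card u2 u3 u1 h23 (inter_le hp₂ hp₁ (Ne.symm c12) _ _ _)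
      · have i12 := inter_le hp₁ hp₂ c12 t₁ t₁ t₂
        have i13 := inter_le hp₁ hp₃ c13 t₁ t₁ t₃
        have i23 := inter_le hp₂ hp₃ c23 t₂ t₂ t₃
        rw [Finset.union_self] at i12 i13 i23
        exact three_card u1 u2 u3 i12 i13 i23

lemma lines_card (r : ℕ) [NeZero r] : r * r ≤ 6 * (lines r).card + 3 * r := by
  classical
  let A := lines r
  let f : Fin r × Fin r → Fin r × Fin r × Fin r := fun p => (p.1, p.2, -(p.1 + p.2))
  let B₁ := (Finset.univ : Finset (Fin r)).image fun x => (x, x)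
  let B₂ := (Finset.univ : Finset (Fin r)).image fun x => (x, -(x + x))
  let B₃ := (Finset.univ : Finset (Fin r)).image fun x => (-(x + x), x)
  let C₁ := A.image fun p => (p.1, p.2.1)
  let C₂ := A.image fun p => (p.2.1, p.1)
  let C₃ := A.image fun p => (p.1, p.2.2)
  let C₄ := A.image fun p => (p.2.2, p.1)
  let C₅ := A.image fun p => (p.2.1, p.2.2)
  let C₆ := A.image fun p => (p.2.2, p.2.1)
  have hsub : (Finset.univ : Finset (Fin r × Fin r)) ⊆
      B₁ ∪ (B₂ ∪ (B₃ ∪ (C₁ ∪ (C₂ ∪ (C₃ ∪ (C₄ ∪ (C₅ ∪ C₆))))))) := by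
    rintro ⟨x, y⟩ -
    obtain ⟨z, hz⟩ : ∃ z, z = -(x + y) := ⟨_, rfl⟩
    have hs : x + y + z = 0 := by rw [hz]; abel
    simp only [Finset.mem_union]
    by_cases hxy : x = y
    · subst hxy; left; simp [B₁]
    right
    by_cases hxz : x = z
    · left
      refine Finset.mem_image.2 ⟨x, Finset.mem_univ _, ?_⟩
      have : y = -(x + x) := by
        rw [eq_neg_iff_add_eq_zero, ← hs, ← hxz]; abel
      rw [this]
    right
    by_cases hyz : y = z
    · left
      refine Finset.mem_image.2 ⟨y, Finset.mem_univ _, ?_⟩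
      have : x = -(y + y) := by
        rw [eq_neg_iff_add_eq_zero, ← hs, ← hyz]; abel
      rw [this]
    right
    have mk : ∀ a b c : Fin r, a < b → b < c → a + b + c = x + y + z → (a, b, c) ∈ A := by
      intro a b c h1 h2 h3
      simp only [A, lines, Finset.mem_filter, Finset.mem_univ, true_and]
      exact ⟨h1, h2, h3.trans hs⟩
    rcases lt_or_gt_of_ne hxy with h1 | h1 <;> rcases lt_or_gt_of_ne hxz with h2 | h2 <;>
      rcases lt_or_gt_of_ne hyz with h3 | h3
    · left; exact Finset.mem_image.2 ⟨_, mk x y z h1 h3 rfl, rfl⟩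
    · right; right; left; exact Finset.mem_image.2 ⟨_, mk x z y h2 h3 (by abel), rfl⟩
    · exact absurd (h1.trans h3) h2.asymm
    · right; right; right; right; left
      exact Finset.mem_image.2 ⟨_, mk z x y h2 h1 (by abel), rfl⟩
    · right; left; exact Finset.mem_image.2 ⟨_, mk y x z h1 h2 (by abel), rfl⟩
    · exact absurd (h2.trans h3) h1.asymm
    · right; right; right; left
      exact Finset.mem_image.2 ⟨_, mk y z x h3 h2 (by abel), rfl⟩
    · right; right; right; right; right
      exact Finset.mem_image.2 ⟨_, mk z y x h3 h1 (by abel), rfl⟩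
  have h0 := Finset.card_le_card hsub
  have hu : (Finset.univ : Finset (Fin r × Fin r)).card = r * r := by simp
  have b1 : B₁.card ≤ r := Finset.card_image_le.trans (by simp)
  have b2 : B₂.card ≤ r := Finset.card_image_le.trans (by simp)
  have b3 : B₃.card ≤ r := Finset.card_image_le.trans (by simp)
  have c1 : C₁.card ≤ A.card := Finset.card_image_le
  have c2 : C₂.card ≤ A.card := Finset.card_image_le
  have c3 : C₃.card ≤ A.card := Finset.card_image_le
  have c4 : C₄.card ≤ A.card := Finset.card_image_le
  have c5 : C₅.card ≤ A.card := Finset.card_image_le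
  have c6 : C₆.card ≤ A.card := Finset.card_image_le
  have d1 := Finset.card_union_le B₁ (B₂ ∪ (B₃ ∪ (C₁ ∪ (C₂ ∪ (C₃ ∪ (C₄ ∪ (C₅ ∪ C₆)))))))
  have d2 := Finset.card_union_le B₂ (B₃ ∪ (C₁ ∪ (C₂ ∪ (C₃ ∪ (C₄ ∪ (C₅ ∪ C₆))))))
  have d3 := Finset.card_union_le B₃ (C₁ ∪ (C₂ ∪ (C₃ ∪ (C₄ ∪ (C₅ ∪ C₆)))))
  have d4 := Finset.card_union_le C₁ (C₂ ∪ (C₃ ∪ (C₄ ∪ (C₅ ∪ C₆))))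
  have d5 := Finset.card_union_le C₂ (C₃ ∪ (C₄ ∪ (C₅ ∪ C₆)))
  have d6 := Finset.card_union_le C₃ (C₄ ∪ (C₅ ∪ C₆))
  have d7 := Finset.card_union_le C₄ (C₅ ∪ C₆)
  have d8 := Finset.card_union_le C₅ C₆
  change r * r ≤ 6 * A.card + 3 * r
  rw [hu] at h0
  omega

end Stmt9

/-- Lower bound: for every `ε > 0` and sufficiently large `n`, there is an
`F⁽³⁾(5,3)`-free 3-uniform hypergraph on `n` vertices with at least `(1/5 - ε)n²` edges. -/
theorem stmt_9 (ε : ℝ) (hε : 0 < ε) :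
    ∃ n₀ : ℕ, ∀ n : ℕ, n₀ ≤ n →
      ∃ G : Finset (Finset (Fin n)),
        (∀ e ∈ G, e.card = 3) ∧
        (∀ e₁ ∈ G, ∀ e₂ ∈ G, ∀ e₃ ∈ G,
          e₁ ≠ e₂ → e₁ ≠ e₃ → e₂ ≠ e₃ → 5 < (e₁ ∪ e₂ ∪ e₃).card) ∧
        (1 / 5 - ε) * (n : ℝ) ^ 2 ≤ (G.card : ℝ) := by
  obtain ⟨N, hN⟩ := exists_nat_gt (5 / ε)
  refine ⟨max N 5, fun n hn => ?_⟩
  have hnN : N ≤ n := (le_max_left _ _).trans hn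
  have hn5 : 5 ≤ n := (le_max_right _ _).trans hn
  obtain ⟨r, hr⟩ : ∃ r, r = n / 5 := ⟨_, rfl⟩
  have hr0 : r ≠ 0 := by omega
  have : NeZero r := ⟨hr0⟩
  let φ : Fin r × Fin 5 ↪ Fin n :=
    finProdFinEquiv.toEmbedding.trans (Fin.castLEEmb (by omega : r * 5 ≤ n))
  refine ⟨(Stmt9.hyp r).map (Finset.mapEmbedding φ).toEmbedding, ?_, ?_, ?_⟩
  · intro e he
    obtain ⟨e, he', rfl⟩ := Finset.mem_map.1 he
    have := Stmt9.hyp_uniform r e he'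
    simpa [Finset.mapEmbedding_apply] using this
  · intro e₁ h₁ e₂ h₂ e₃ h₃ h12 h13 h23
    obtain ⟨e₁, g₁, rfl⟩ := Finset.mem_map.1 h₁
    obtain ⟨e₂, g₂, rfl⟩ := Finset.mem_map.1 h₂
    obtain ⟨e₃, g₃, rfl⟩ := Finset.mem_map.1 h₃
    have := Stmt9.hyp_free r e₁ g₁ e₂ g₂ e₃ g₃ (by rintro rfl; exact h12 rfl)
      (by rintro rfl; exact h13 rfl) (by rintro rfl; exact h23 rfl)
    simp only [RelEmbedding.coe_toEmbedding, Finset.mapEmbedding_apply]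
    rw [← Finset.map_union, ← Finset.map_union, Finset.card_map]
    exact this
  · rw [Finset.card_map, Stmt9.hyp_card]
    have hl := Stmt9.lines_card r
    have hl' : (r : ℝ) * r ≤ 6 * ((Stmt9.lines r).card : ℝ) + 3 * r := by exact_mod_cast hl
    have hnr : (n : ℝ) ≤ 5 * r + 4 := by
      have : n ≤ 5 * r + 4 := by omega
      exact_mod_cast this
    have hrn : 5 * (r : ℝ) ≤ n := by
      have : 5 * r ≤ n := by omega
      exact_mod_cast this
    have hNn : (N : ℝ) ≤ n := by exact_mod_cast hnN
    have h5 : 5 < ε * n := by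
      have := hN.trans_le hNn
      rw [div_lt_iff₀ hε] at this
      linarith
    push_cast
    have hn0 : (5 : ℝ) ≤ n := by exact_mod_cast hn5
    have e1 : 5 * (n : ℝ) ≤ ε * n * n := by nlinarith
    have e2 : (n - 4 : ℝ) * (n - 4) ≤ (5 * r) * (5 * r) := by
      apply mul_self_le_mul_self <;> linarith
    nlinarith
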